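/- arXiv:2101.00302 — 4 statements merged into one kernel-verified Lean document; each statement's English description precedes it below -/
import Mathlib

section
/- Let C = (c_n)_{n≥0} be a complex sequence and r a positive integer. Then C has moment rank r if and only if there exist nonzero complex numbers α_1,…,α_r, β_1,…,β_r, λ_1,…,λ_r such that the values β_1/α_1,…,β_r/α_r are pairwise distinct and, for each t ≥ 0, the identity of binary forms Σ_{j=0}^{2r} C(2r,j) c_{j+t} x^{2r-j} y^{j} = Σ_{j=1}^{r} λ_j (β_j/α_j)^t (α_j x + β_j y)^{2r} holds in ℂ[x,y], where C(2r,j) denotes the binomial coefficient. -/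
/-- `c` has moment rank `r`. -/
def MomentRank (c : ℕ → ℂ) (r : ℕ) : Prop :=
  IsLeast {s : ℕ | 0 < s ∧ ∃ α β : Fin s → ℂ,
    (∀ i, α i ≠ 0) ∧ (∀ i, β i ≠ 0) ∧ Function.Injective β ∧
    ∀ n : ℕ, c n = ∑ i, α i * β i ^ (n + 1)} r

/-- Two equal power sums have equal weighted sums of every polynomial over their nodes. -/
theorem sum_mul_eval_eq_of_sum_mul_pow_eq {R ι κ : Type*} [CommSemiring R] [Fintype ι] [Fintype κ]
    {a γ : ι → R} {b δ : κ → R}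
    (h : ∀ n : ℕ, ∑ i, a i * γ i ^ n = ∑ k, b k * δ k ^ n) (Q : Polynomial R) :
    ∑ i, a i * Q.eval (γ i) = ∑ k, b k * Q.eval (δ k) := by
  simp only [Polynomial.eval_eq_sum_range, Finset.mul_sum]
  rw [Finset.sum_comm, Finset.sum_comm (s := Finset.univ)]
  refine Finset.sum_congr rfl fun n _ => ?_
  simpa [Finset.mul_sum, mul_left_comm] using congrArg (Q.coeff n * ·) (h n)

/-- A node carrying a nonzero weight in a power sum with distinct nodes occurs in every other
representation of that power sum. -/
theorem exists_node_eq_of_sum_mul_pow_eq {R ι κ : Type*} [CommRing R] [IsDomain R]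
    [Fintype ι] [Fintype κ] {a γ : ι → R} {b δ : κ → R} (hγ : Function.Injective γ)
    (h : ∀ n : ℕ, ∑ i, a i * γ i ^ n = ∑ k, b k * δ k ^ n) {i : ι} (hi : a i ≠ 0) :
    ∃ k, δ k = γ i := by
  classical
  by_contra! hne
  have key := sum_mul_eval_eq_of_sum_mul_pow_eq h
    ((∏ k, (Polynomial.X - Polynomial.C (δ k))) *
      ∏ j ∈ Finset.univ.erase i, (Polynomial.X - Polynomial.C (γ j)))
  simp only [Polynomial.eval_mul, Polynomial.eval_prod, Polynomial.eval_sub, Polynomial.eval_X,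
    Polynomial.eval_C] at key
  rw [Finset.sum_eq_single i, Finset.sum_eq_zero] at key
  · refine mul_ne_zero hi (mul_ne_zero ?_ ?_) key
    · exact Finset.prod_ne_zero_iff.2 fun k _ => sub_ne_zero.2 (hne k).symm
    · exact Finset.prod_ne_zero_iff.2 fun j hj =>
        sub_ne_zero.2 fun e => Finset.ne_of_mem_erase hj (hγ e).symm
  · intro k _
    rw [Finset.prod_eq_zero (Finset.mem_univ k) (sub_self _), zero_mul, mul_zero]
  · intro j _ hj
    rw [Finset.prod_eq_zero (s := Finset.univ.erase i) (i := j) (by simpa using hj) (sub_self _),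
      mul_zero, mul_zero]
  · simp

/-- A power sum with `r` distinct nodes and nonzero weights is not a power sum of fewer nodes. -/
theorem card_le_card_of_sum_mul_pow_eq {R ι κ : Type*} [CommRing R] [IsDomain R]
    [Fintype ι] [Fintype κ] {a γ : ι → R} {b δ : κ → R} (ha : ∀ i, a i ≠ 0)
    (hγ : Function.Injective γ)
    (h : ∀ n : ℕ, ∑ i, a i * γ i ^ n = ∑ k, b k * δ k ^ n) :
    Fintype.card ι ≤ Fintype.card κ := by
  choose f hf using fun i => exists_node_eq_of_sum_mul_pow_eq hγ h (ha i)
  exact Fintype.card_le_of_injective f fun i j hij => hγ (by rw [← hf i, ← hf j, hij])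

/-- The binary form attached to a shift of a power sum is a sum of powers of linear forms. -/
theorem binaryForm_eq_sum_linear_pow {R ι : Type*} [CommSemiring R] [Fintype ι] (w γ : ι → R)
    (m t : ℕ) :
    (∑ j ∈ Finset.range (m + 1),
        MvPolynomial.C ((Nat.choose m j : R) * ∑ i, w i * γ i ^ (j + t)) *
          MvPolynomial.X (0 : Fin 2) ^ (m - j) * MvPolynomial.X 1 ^ j) =
      ∑ i, MvPolynomial.C (w i * γ i ^ t) *
        (MvPolynomial.X (0 : Fin 2) + MvPolynomial.C (γ i) * MvPolynomial.X 1) ^ m := by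
  simp only [add_comm (MvPolynomial.X (0 : Fin 2)), add_pow, Finset.mul_sum, map_sum,
    Finset.sum_mul]
  rw [Finset.sum_comm]
  refine Finset.sum_congr rfl fun i _ => Finset.sum_congr rfl fun j _ => ?_
  simp only [map_mul, map_pow, map_natCast, mul_pow]
  ring

/-- `c` has moment rank `r` iff there are nonzero complex numbers
`αⱼ, βⱼ, λⱼ` (`1 ≤ j ≤ r`) with the `βⱼ/αⱼ` pairwise distinct such that for every `t ≥ 0`
the binary form `Σⱼ C(2r,j) c_{j+t} x^{2r-j} y^j` equals
`Σⱼ λⱼ (βⱼ/αⱼ)^t (αⱼ x + βⱼ y)^{2r}` in `ℂ[x,y]`. -/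
theorem momentRank_iff_waring (c : ℕ → ℂ) (r : ℕ) (hr : 0 < r) :
    MomentRank c r ↔
      ∃ α β lam : Fin r → ℂ,
        (∀ i, α i ≠ 0) ∧ (∀ i, β i ≠ 0) ∧ (∀ i, lam i ≠ 0) ∧
        Function.Injective (fun i => β i / α i) ∧
        ∀ t : ℕ,
          (∑ j ∈ Finset.range (2 * r + 1),
              MvPolynomial.C ((Nat.choose (2 * r) j : ℂ) * c (j + t)) *
                MvPolynomial.X (0 : Fin 2) ^ (2 * r - j) * MvPolynomial.X 1 ^ j) =
            ∑ i : Fin r,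
              MvPolynomial.C (lam i * (β i / α i) ^ t) *
                (MvPolynomial.C (α i) * MvPolynomial.X (0 : Fin 2) +
                  MvPolynomial.C (β i) * MvPolynomial.X 1) ^ (2 * r) := by
  constructor
  · rintro ⟨⟨-, a, γ, ha, hγ0, hγ, hc⟩, -⟩
    refine ⟨fun _ => 1, γ, fun i => a i * γ i, by simp, hγ0,
      fun i => mul_ne_zero (ha i) (hγ0 i), by simpa using hγ, fun t => ?_⟩
    have hc' : ∀ n, c n = ∑ i, a i * γ i * γ i ^ n := fun n => by
      simp only [hc, pow_succ', mul_assoc]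
    simpa [hc'] using binaryForm_eq_sum_linear_pow (fun i => a i * γ i) γ (2 * r) t
  · rintro ⟨α, β, lam, hα, hβ, hlam, hinj, H⟩
    have hγ0 : ∀ i, β i / α i ≠ 0 := fun i => div_ne_zero (hβ i) (hα i)
    have hw : ∀ i, lam i * α i ^ (2 * r) ≠ 0 := fun i =>
      mul_ne_zero (hlam i) (pow_ne_zero _ (hα i))
    have hc : ∀ n, c n = ∑ i, lam i * α i ^ (2 * r) * (β i / α i) ^ n := fun n => by
      have e := congrArg (MvPolynomial.eval ![(1 : ℂ), 0]) (H n)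
      simpa [Finset.sum_range_succ', mul_right_comm] using e
    refine ⟨⟨hr, fun i => lam i * α i ^ (2 * r) / (β i / α i), fun i => β i / α i,
      fun i => div_ne_zero (hw i) (hγ0 i), hγ0, hinj, fun n => ?_⟩, ?_⟩
    · rw [hc]
      refine Finset.sum_congr rfl fun i _ => ?_
      rw [pow_succ', ← mul_assoc, div_mul_cancel₀ _ (hγ0 i)]
    · rintro s ⟨-, b, δ, -, -, -, hb⟩
      have hle := card_le_card_of_sum_mul_pow_eq (b := fun k => b k * δ k) (δ := δ) hw hinj
        fun n => by simpa only [pow_succ', ← mul_assoc] using (hc n).symm.trans (hb n)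
      simpa using hle
end

section
/- Let C = (c_n)_{n≥0} be a complex sequence and r a positive integer. For m,t ≥ 0, let H_{m,t} be the (m+1)×(m+1) Hankel matrix with (i,j) entry (0-indexed) c_{t+i+j}. Then C has moment rank r if and only if: det(H_{r-1,t}) ≠ 0 for every t ≥ 0; the kernel of H_{r,0} is one-dimensional; ker(H_{r,t}) = ker(H_{r,0}) for every t ≥ 0; and for every nonzero vector (a_0,…,a_r) in ker(H_{r,0}), the polynomial Σ_{j=0}^r a_j x^j has no repeated root (i.e., the kernel is not contained in the discriminant variety ∇_r). -/
/-- The `(m+1) × (m+1)` Hankel matrix `H_{m,t}` with `(i,j)` entry `c (t+i+j)`. -/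
def Hmat (c : ℕ → ℂ) (m t : ℕ) : Matrix (Fin (m + 1)) (Fin (m + 1)) ℂ :=
  Matrix.of fun i j => c (t + (i : ℕ) + (j : ℕ))

open Polynomial in
theorem eval_ofFn_eq_sum {R : Type*} [Semiring R] [DecidableEq R] {n : ℕ} (a : Fin n → R) (x : R) :
    (ofFn n a).eval x = ∑ j, a j * x ^ (j : ℕ) := by
  simp [ofFn_eq_sum_monomial, eval_finsetSum]

theorem Hmat_mulVec_apply (c : ℕ → ℂ) (m t : ℕ) (a : Fin (m + 1) → ℂ) (i : Fin (m + 1)) :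
    (Hmat c m t).mulVec a i = ∑ j : Fin (m + 1), c (t + i + j) * a j := rfl

theorem Hmat_mulVec_of_eq_sum {ι : Type*} {c : ℕ → ℂ} {S : Finset ι} {α β : ι → ℂ}
    (hc : ∀ n, c n = ∑ l ∈ S, α l * β l ^ (n + 1)) (m t : ℕ) (a : Fin (m + 1) → ℂ)
    (i : Fin (m + 1)) :
    (Hmat c m t).mulVec a i =
      ∑ l ∈ S, α l * β l ^ (t + i + 1) * (Polynomial.ofFn (m + 1) a).eval (β l) := by
  simp_rw [Hmat_mulVec_apply, hc, eval_ofFn_eq_sum, Finset.sum_mul, Finset.mul_sum]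
  rw [Finset.sum_comm]
  exact Finset.sum_congr rfl fun l _ => Finset.sum_congr rfl fun j _ => by ring

/-- An exponential sum with at most `m` terms has singular Hankel matrices of size `m + 1`. -/
theorem det_Hmat_eq_zero_of_card_le {ι : Type*} {c : ℕ → ℂ} {S : Finset ι} {α β : ι → ℂ}
    (hc : ∀ n, c n = ∑ l ∈ S, α l * β l ^ (n + 1)) {m : ℕ} (hS : S.card ≤ m) (t : ℕ) :
    (Hmat c m t).det = 0 := by
  set p : Polynomial ℂ := ∏ l ∈ S, (Polynomial.X - Polynomial.C (β l)) with hp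
  have hdeg : p.natDegree < m + 1 := by
    rw [hp, Polynomial.natDegree_finsetProd_X_sub_C_eq_card]
    omega
  have hof := Polynomial.ofFn_comp_toFn_eq_id_of_natDegree_lt hdeg
  rw [← Matrix.exists_mulVec_eq_zero_iff]
  refine ⟨Polynomial.toFn (m + 1) p, fun h => ?_, ?_⟩
  · rw [h, Polynomial.ofFn_zero] at hof
    exact (Polynomial.monic_prod_X_sub_C β S).ne_zero hof.symm
  · funext i
    rw [Hmat_mulVec_of_eq_sum hc, hof]
    refine Finset.sum_eq_zero fun l hl => ?_
    have : p.eval (β l) = 0 := by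
      rw [hp, Polynomial.eval_prod]
      exact Finset.prod_eq_zero hl (by simp)
    rw [this, mul_zero]

theorem Hmat_mulVec_eq_zero_iff {c : ℕ → ℂ} {r : ℕ} {α β : Fin r → ℂ}
    (hα : ∀ i, α i ≠ 0) (hβ : ∀ i, β i ≠ 0) (hinj : Function.Injective β)
    (hc : ∀ n, c n = ∑ i, α i * β i ^ (n + 1)) {m : ℕ} (hm : r ≤ m + 1) (t : ℕ)
    (a : Fin (m + 1) → ℂ) :
    (Hmat c m t).mulVec a = 0 ↔ ∀ l, (Polynomial.ofFn (m + 1) a).eval (β l) = 0 := by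
  refine ⟨fun h => ?_, fun h => ?_⟩
  · have hv := Matrix.eq_zero_of_forall_pow_sum_mul_pow_eq_zero
      (v := fun l => α l * β l ^ (t + 1) * (Polynomial.ofFn (m + 1) a).eval (β l)) hinj
      fun i => by
        have hi := congrFun h (Fin.castLE hm i)
        rw [Hmat_mulVec_of_eq_sum hc] at hi
        rw [← hi.trans (Pi.zero_apply _)]
        refine Finset.sum_congr rfl fun l _ => ?_
        rw [Fin.val_castLE]
        ring
    intro l
    have hl := congrFun hv l
    simpa [hα l, hβ l] using hl
  · funext i
    rw [Hmat_mulVec_of_eq_sum hc]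
    exact Finset.sum_eq_zero fun l _ => by rw [h l, mul_zero]

theorem eq_zero_of_eval_ofFn_eq_zero {R : Type*} [CommRing R] [IsDomain R] [DecidableEq R]
    {r : ℕ} {β : Fin r → R} (hinj : Function.Injective β) {n : ℕ} (hn : n ≤ r) {a : Fin n → R}
    (h : ∀ l, (Polynomial.ofFn n a).eval (β l) = 0) : a = 0 := by
  refine Polynomial.injective_ofFn n ?_
  rw [Polynomial.ofFn_zero]
  refine Polynomial.eq_zero_of_degree_lt_of_eval_index_eq_zero (s := Finset.univ)
    hinj.injOn ?_ fun l _ => h l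
  refine (Polynomial.ofFn_degree_lt a).trans_le ?_
  simpa using hn

theorem eq_of_linear_recurrence {K : Type*} [Field K] {k : ℕ} {v : Fin (k + 1) → K}
    (hv : v (Fin.last k) ≠ 0) {c d : ℕ → K} (hc : ∀ t, ∑ j : Fin (k + 1), c (t + (j : ℕ)) * v j = 0)
    (hd : ∀ t, ∑ j : Fin (k + 1), d (t + (j : ℕ)) * v j = 0) (hcd : ∀ n < k, c n = d n) : c = d := by
  funext n
  induction n using Nat.strong_induction_on with
  | _ n ih =>
    rcases lt_or_ge n k with hn | hn
    · exact hcd n hn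
    · obtain ⟨t, rfl⟩ := Nat.exists_eq_add_of_le' hn
      have h := (hc t).trans (hd t).symm
      rw [Fin.sum_univ_castSucc, Fin.sum_univ_castSucc,
        Finset.sum_congr rfl fun j _ => by
          rw [ih (t + (Fin.castSucc j : Fin (k + 1))) (by simp)]] at h
      exact mul_right_cancel₀ hv (add_left_cancel h)

theorem exists_sum_mul_pow_succ_eq {K : Type*} [Field K] {r : ℕ} {β : Fin r → K}
    (hβ : ∀ i, β i ≠ 0) (hinj : Function.Injective β) (c : ℕ → K) :
    ∃ α : Fin r → K, ∀ n < r, c n = ∑ i, α i * β i ^ (n + 1) := by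
  have hu : IsUnit (Matrix.vandermonde β).transpose := by
    rw [Matrix.isUnit_iff_isUnit_det, Matrix.det_transpose, isUnit_iff_ne_zero]
    exact Matrix.det_vandermonde_ne_zero_iff.2 hinj
  obtain ⟨γ, hγ⟩ := Matrix.mulVec_surjective_iff_isUnit.2 hu fun i => c i
  refine ⟨fun i => γ i / β i, fun n hn => ?_⟩
  rw [← congrFun hγ ⟨n, hn⟩, Matrix.mulVec_eq_sum, Finset.sum_apply]
  refine Finset.sum_congr rfl fun i _ => ?_
  have := hβ i
  simp only [Matrix.transpose_transpose, Pi.smul_apply, Matrix.vandermonde_apply,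
    MulOpposite.smul_eq_mul_unop, MulOpposite.unop_op]
  field_simp
  ring

theorem sum_C_mul_X_pow_eq_ofFn {n : ℕ} (a : Fin n → ℂ) :
    (∑ j : Fin n, Polynomial.C (a j) * Polynomial.X ^ (j : ℕ)) = Polynomial.ofFn n a := by
  simp [Polynomial.ofFn_eq_sum_monomial, Polynomial.C_mul_X_pow_eq_monomial]

theorem MomentRank.hankel_kernels {c : ℕ → ℂ} {k : ℕ} (h : MomentRank c (k + 1)) :
    (∀ t : ℕ, (Hmat c k t).det ≠ 0) ∧
      Module.finrank ℂ (LinearMap.ker (Hmat c (k + 1) 0).mulVecLin) = 1 ∧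
      (∀ t : ℕ, LinearMap.ker (Hmat c (k + 1) t).mulVecLin =
        LinearMap.ker (Hmat c (k + 1) 0).mulVecLin) ∧
      (∀ a : Fin (k + 2) → ℂ, (Hmat c (k + 1) 0).mulVec a = 0 → a ≠ 0 →
        (Polynomial.ofFn (k + 2) a).roots.Nodup) := by
  obtain ⟨⟨-, α, β, hα, hβ, hinj, hc⟩, -⟩ := h
  have hker := fun t a => Hmat_mulVec_eq_zero_iff hα hβ hinj hc (m := k + 1) (by omega) t a
  refine ⟨fun t hdet => ?_, ?_, fun t => ?_, fun a ha ha0 => ?_⟩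
  · obtain ⟨a, ha0, ha⟩ := Matrix.exists_mulVec_eq_zero_iff.2 hdet
    exact ha0 (eq_zero_of_eval_ofFn_eq_zero hinj le_rfl
      ((Hmat_mulVec_eq_zero_iff hα hβ hinj hc le_rfl t a).1 ha))
  · obtain ⟨v, hv0, hv⟩ := Matrix.exists_mulVec_eq_zero_iff.2
      (det_Hmat_eq_zero_of_card_le hc (m := k + 1) (by simp) 0)
    have hlast : ∀ w : Fin (k + 2) → ℂ, (Hmat c (k + 1) 0).mulVec w = 0 →
        w (Fin.last (k + 1)) = 0 → w = 0 := fun w hw hw0 => by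
      have hinit : Fin.init w = 0 := by
        refine eq_zero_of_eval_ofFn_eq_zero hinj le_rfl fun l => ?_
        have := (hker 0 w).1 hw l
        rw [eval_ofFn_eq_sum, Fin.sum_univ_castSucc, hw0, zero_mul, add_zero] at this
        rwa [eval_ofFn_eq_sum]
      funext j
      refine Fin.lastCases hw0 (fun i => congrFun hinit i) j
    have hvl : v (Fin.last (k + 1)) ≠ 0 := fun h => hv0 (hlast v hv h)
    rw [finrank_eq_one_iff']
    refine ⟨⟨v, hv⟩, fun h => hv0 (congrArg Subtype.val h), fun w =>
      ⟨w.1 (Fin.last (k + 1)) / v (Fin.last (k + 1)), Subtype.ext ?_⟩⟩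
    have hw : (Hmat c (k + 1) 0).mulVec w.1 = 0 := w.2
    refine sub_eq_zero.1 (hlast _ ?_ ?_)
    · simp [Matrix.mulVec_sub, Matrix.mulVec_smul, hv, hw]
    · simp [hvl]
  · ext a
    exact (hker t a).trans (hker 0 a).symm
  · have hp : Polynomial.ofFn (k + 2) a ≠ 0 := fun h =>
      ha0 (Polynomial.injective_ofFn _ (h.trans (Polynomial.ofFn_zero _).symm))
    classical
    rw [← Multiset.toFinset_card_eq_card_iff_nodup]
    refine le_antisymm (Multiset.toFinset_card_le _) ?_
    have hcard : (Polynomial.ofFn (k + 2) a).roots.card ≤ k + 1 :=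
      (Polynomial.card_roots' _).trans
        (Nat.lt_succ_iff.1 (Polynomial.ofFn_natDegree_lt (by omega) a))
    have hsub : Finset.univ.image β ⊆ (Polynomial.ofFn (k + 2) a).roots.toFinset := by
      intro x hx
      obtain ⟨l, -, rfl⟩ := Finset.mem_image.1 hx
      simpa [hp] using (hker 0 a).1 ha l
    have := Finset.card_le_card hsub
    rw [Finset.card_image_of_injective _ hinj, Finset.card_univ, Fintype.card_fin] at this
    omega

theorem momentRank_of_hankel_kernels {c : ℕ → ℂ} {k : ℕ} (hdet : ∀ t : ℕ, (Hmat c k t).det ≠ 0)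
    {v : Fin (k + 2) → ℂ} (hv0 : v ≠ 0) (hv : ∀ t, (Hmat c (k + 1) t).mulVec v = 0)
    (hroots : (Polynomial.ofFn (k + 2) v).roots.Nodup) : MomentRank c (k + 1) := by
  have hrec : ∀ t, ∑ j : Fin (k + 2), c (t + (j : ℕ)) * v j = 0 := fun t => by
    simpa [Hmat_mulVec_apply] using congrFun (hv t) 0
  have hlast : v (Fin.last (k + 1)) ≠ 0 := fun h => by
    have hinit : (fun j : Fin (k + 1) => v j.castSucc) = 0 := by
      refine Matrix.eq_zero_of_mulVec_eq_zero (hdet 0) (funext fun i => ?_)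
      have := hrec (0 + i)
      rwa [Fin.sum_univ_castSucc, h, mul_zero, add_zero] at this
    exact hv0 (funext fun j => Fin.lastCases h (fun i => congrFun hinit i) j)
  have hfirst : v 0 ≠ 0 := fun h => by
    have htail : (fun j : Fin (k + 1) => v j.succ) = 0 := by
      refine Matrix.eq_zero_of_mulVec_eq_zero (hdet 1) (funext fun i => ?_)
      have := hrec i
      rw [Fin.sum_univ_succ, h, mul_zero, zero_add] at this
      rw [Hmat_mulVec_apply, Pi.zero_apply, ← this]
      refine Finset.sum_congr rfl fun j _ => ?_
      rw [Fin.val_succ, show 1 + (i : ℕ) + j = i + (j + 1) by ring]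
    exact hv0 (funext fun j => Fin.cases h (fun i => congrFun htail i) j)
  set p := Polynomial.ofFn (k + 2) v with hp
  have hp0 : p ≠ 0 := fun h =>
    hv0 (Polynomial.injective_ofFn _ (h.trans (Polynomial.ofFn_zero _).symm))
  have hdeg : p.natDegree = k + 1 := by
    refine le_antisymm (Nat.lt_succ_iff.1 (Polynomial.ofFn_natDegree_lt (by omega) v))
      (Polynomial.le_natDegree_of_ne_zero ?_)
    rwa [hp, Polynomial.ofFn_coeff_eq_val_of_lt v (Nat.lt_succ_self (k + 1))]
  have hcard : p.roots.toFinset.card = k + 1 := by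
    rw [Multiset.toFinset_card_of_nodup hroots, IsAlgClosed.card_roots_eq_natDegree, hdeg]
  let e := (Finset.equivFinOfCardEq hcard).symm
  let β : Fin (k + 1) → ℂ := fun i => e i
  have hinj : Function.Injective β := Subtype.val_injective.comp e.injective
  have heval : ∀ i, p.eval (β i) = 0 := fun i => by
    have := (e i).2
    rw [Multiset.mem_toFinset, Polynomial.mem_roots hp0] at this
    exact this
  have hβ : ∀ i, β i ≠ 0 := fun i h => by
    have := heval i
    rw [h, ← Polynomial.coeff_zero_eq_eval_zero, hp,
      Polynomial.ofFn_coeff_eq_val_of_lt v (Nat.succ_pos (k + 1))] at this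
    exact hfirst this
  obtain ⟨α, hα⟩ := exists_sum_mul_pow_succ_eq hβ hinj c
  have hc : ∀ n, c n = ∑ i, α i * β i ^ (n + 1) := by
    refine congrFun (eq_of_linear_recurrence hlast hrec (fun t => ?_) hα)
    have := Hmat_mulVec_of_eq_sum (S := Finset.univ) (α := α) (β := β) (fun _ => rfl)
      (k + 1) t v 0
    rw [Hmat_mulVec_apply, Finset.sum_eq_zero (s := Finset.univ)
      (f := fun l => _ * Polynomial.eval (β l) _) fun l _ => by
        rw [← hp, heval l, mul_zero]] at this
    simpa using this
  refine ⟨⟨k.succ_pos, α, β, fun i hi => hdet 0 ?_, hβ, hinj, hc⟩, ?_⟩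
  · refine det_Hmat_eq_zero_of_card_le (S := Finset.univ.erase i) (α := α) (β := β)
      (fun n => ?_) (by simp) 0
    rw [hc n, ← Finset.add_sum_erase _ _ (Finset.mem_univ i), hi, zero_mul, zero_add]
  · rintro s ⟨-, α', β', -, -, -, hc'⟩
    by_contra! hs
    exact hdet 0 (det_Hmat_eq_zero_of_card_le hc' (by simpa using Nat.lt_succ_iff.1 hs) 0)

/-- `c` has moment rank `r` iff `det H_{r-1,t} ≠ 0` for all `t`, the kernel
of `H_{r,0}` is one-dimensional, `ker H_{r,t} = ker H_{r,0}` for all `t`, and every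
nonzero kernel vector `(a₀,…,a_r)` yields a polynomial `Σ aⱼ xʲ` with no repeated root
(the kernel is not contained in the discriminant variety). -/
theorem momentRank_iff_hankel_kernels (c : ℕ → ℂ) (r : ℕ) (hr : 0 < r) :
    MomentRank c r ↔
      ((∀ t : ℕ, (Hmat c (r - 1) t).det ≠ 0) ∧
        Module.finrank ℂ (LinearMap.ker (Hmat c r 0).mulVecLin) = 1 ∧
        (∀ t : ℕ, LinearMap.ker (Hmat c r t).mulVecLin =
          LinearMap.ker (Hmat c r 0).mulVecLin) ∧
        (∀ a : Fin (r + 1) → ℂ, (Hmat c r 0).mulVec a = 0 → a ≠ 0 →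
          (∑ j : Fin (r + 1), Polynomial.C (a j) * Polynomial.X ^ (j : ℕ)).roots.Nodup)) := by
  obtain ⟨k, rfl⟩ := Nat.exists_eq_add_of_le' hr
  simp_rw [sum_C_mul_X_pow_eq_ofFn]
  refine ⟨fun h => h.hankel_kernels, fun ⟨hdet, hfin, hker, hroots⟩ => ?_⟩
  obtain ⟨⟨v, hv⟩, hv0, -⟩ := finrank_eq_one_iff'.1 hfin
  have hv0' : v ≠ 0 := fun h => hv0 (Subtype.ext h)
  exact momentRank_of_hankel_kernels hdet hv0'
    (fun t => (hker t).symm.le hv) (hroots v hv hv0')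
end

section
/- Let C = (c_n)_{n≥1} be a complex sequence and r a positive integer. Define c'_0 = r and c'_n = c_n for n ≥ 1, and let H'_∞ be the infinite Hankel matrix with (i,j) entry c'_{i+j} for i,j ≥ 0. Then C has unitary rank r if and only if there exist nonzero complex numbers β_1,…,β_r such that H'_∞ = V^T V, where V is the r×∞ Vandermonde matrix whose i-th row is (β_i^j)_{j≥0}. -/
open Matrix

/-- `c` (regarded as a sequence indexed by `n ≥ 1`) has unitary rank `r`. -/
def UnitaryRank (c : ℕ → ℂ) (r : ℕ) : Prop :=
  IsLeast {s : ℕ | 0 < s ∧ ∃ β : Multiset ℂ, Multiset.card β = s ∧ (0 : ℂ) ∉ β ∧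
    ∀ n : ℕ, 1 ≤ n → c n = (β.map (· ^ n)).sum} r

/-- The augmented sequence `c'` with `c'_0 = r` and `c'_n = c_n` for `n ≥ 1`. -/
noncomputable def augSeq (c : ℕ → ℂ) (r : ℕ) : ℕ → ℂ :=
  fun n => if n = 0 then (r : ℂ) else c n

open Polynomial in
/-- Multisets with the same positive power sums have the same sums of `p.eval x - p.eval 0`. -/
theorem Multiset.sum_eval_sub_eq_of_sum_pow_eq {R : Type*} [CommRing R] {s t : Multiset R}
    (h : ∀ n : ℕ, 1 ≤ n → (s.map (· ^ n)).sum = (t.map (· ^ n)).sum) (p : R[X]) :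
    (s.map fun x => p.eval x - p.eval 0).sum = (t.map fun x => p.eval x - p.eval 0).sum := by
  induction p using Polynomial.induction_on' with
  | add p q hp hq =>
    simp only [eval_add, add_sub_add_comm, Multiset.sum_map_add, hp, hq]
  | monomial n a =>
    rcases Nat.eq_zero_or_pos n with rfl | hn
    · simp
    · simp [eval_monomial, zero_pow hn.ne', Multiset.sum_map_mul_left, h n hn]

open Polynomial in
/-- Multisets of nonzero elements with the same positive power sums have the same cardinality. -/
theorem Multiset.card_eq_of_sum_pow_eq {R : Type*} [CommRing R] [IsDomain R] [CharZero R]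
    {s t : Multiset R} (hs : (0 : R) ∉ s) (ht : (0 : R) ∉ t)
    (h : ∀ n : ℕ, 1 ≤ n → (s.map (· ^ n)).sum = (t.map (· ^ n)).sum) :
    Multiset.card s = Multiset.card t := by
  set q : R[X] := ((s + t).map fun a => X - C a).prod
  have root : ∀ x, q.eval x = 0 ↔ x ∈ s + t := fun x => by
    rw [← IsRoot.def, ← mem_roots (monic_multiset_prod_of_monic _ _ fun a _ =>
      monic_X_sub_C a).ne_zero, roots_multiset_prod_X_sub_C]
  have hq0 : q.eval 0 ≠ 0 := by
    rw [Ne, root, Multiset.mem_add]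
    tauto
  have key := sum_eval_sub_eq_of_sum_pow_eq h q
  rw [Multiset.map_congr rfl (g := fun _ => -q.eval 0) fun x hx => by
      rw [(root x).2 (Multiset.mem_add.2 (.inl hx)), zero_sub],
    Multiset.map_congr (s := t) rfl (g := fun _ => -q.eval 0) fun x hx => by
      rw [(root x).2 (Multiset.mem_add.2 (.inr hx)), zero_sub]] at key
  simpa [hq0] using key

/-- A representation of `c` by power sums of `r` nonzero numbers already has minimal size. -/
theorem unitaryRank_iff_exists (c : ℕ → ℂ) {r : ℕ} (hr : 0 < r) :
    UnitaryRank c r ↔ ∃ β : Fin r → ℂ, (∀ i, β i ≠ 0) ∧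
      ∀ n : ℕ, 1 ≤ n → c n = ∑ i, β i ^ n := by
  constructor
  · rintro ⟨⟨-, s, hs, h0, h⟩, -⟩
    induction s using Quotient.inductionOn with
    | h l =>
      obtain rfl : l.length = r := by simpa using hs
      refine ⟨l.get, fun i hi => h0 ?_, fun n hn => ?_⟩
      · simp [← hi]
      · simpa [Fin.sum_univ_fun_getElem l (· ^ n)] using h n hn
  · rintro ⟨β, h0, h⟩
    have h0' : (0 : ℂ) ∉ Finset.univ.val.map β := by simpa using h0
    have h' : ∀ n : ℕ, 1 ≤ n → c n = ((Finset.univ.val.map β).map (· ^ n)).sum := fun n hn => by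
      rw [h n hn, Multiset.map_map]
      rfl
    refine ⟨⟨hr, _, by simp, h0', h'⟩, ?_⟩
    rintro m ⟨-, t, rfl, ht0, ht⟩
    have := Multiset.card_eq_of_sum_pow_eq h0' ht0 fun n hn => (h' n hn).symm.trans (ht n hn)
    simpa using this.le

/-- `c` has unitary rank `r` iff, setting `c'_0 = r` and `c'_n = c_n`
for `n ≥ 1`, the infinite Hankel matrix `H'_∞` (with `(i,j)` entry `c'_{i+j}`) factors
as `Vᵀ V` for an `r × ∞` Vandermonde matrix `V` with rows `(βᵢ^j)_{j≥0}`, all `βᵢ ≠ 0`. -/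
theorem unitaryRank_iff_hankel_gram (c : ℕ → ℂ) (r : ℕ) (hr : 0 < r) :
    UnitaryRank c r ↔
      ∃ β : Fin r → ℂ, (∀ i, β i ≠ 0) ∧
        (Matrix.of fun i j : ℕ => augSeq c r (i + j)) =
          (Matrix.of fun (i : Fin r) (j : ℕ) => β i ^ j)ᵀ *
            (Matrix.of fun (i : Fin r) (j : ℕ) => β i ^ j) := by
  rw [unitaryRank_iff_exists c hr]
  refine exists_congr fun β => and_congr_right fun _ => ⟨fun h => ?_, fun h n hn => ?_⟩
  · ext i j
    simp only [Matrix.of_apply, Matrix.mul_apply, Matrix.transpose_apply, ← pow_add, augSeq]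
    split_ifs with hij
    · simp [hij]
    · exact h _ (Nat.one_le_iff_ne_zero.2 hij)
  · simpa [Matrix.mul_apply, augSeq, Nat.one_le_iff_ne_zero.1 hn] using congrFun (congrFun h n) 0
end

section
/- Let C = (c_n)_{n≥1} be a complex sequence and r a positive integer. Define c'_0 = r and c'_n = c_n for n ≥ 1, and for t ≥ 0 let H'_{r-1,t} be the r×r Hankel matrix with (i,j) entry (0-indexed) c'_{t+i+j}. Then C has unitary rank r if and only if there exist nonzero complex numbers β_1,…,β_r such that for every t ≥ 0, H'_{r-1,t} = V^T D^t V, where V is the r×r Vandermonde matrix with (i,j) entry (0-indexed rows i = 1,…,r, columns j = 0,…,r-1) β_i^j and D = diag(β_1,…,β_r). -/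
open Matrix

/-- If two multisets of nonzero complex numbers have the same power sums of every positive
exponent, then they have the same cardinality. -/
theorem Multiset.card_eq_of_sum_map_pow_eq {β γ : Multiset ℂ} (hβ : (0 : ℂ) ∉ β)
    (hγ : (0 : ℂ) ∉ γ)
    (h : ∀ n : ℕ, 1 ≤ n → (β.map (· ^ n)).sum = (γ.map (· ^ n)).sum) :
    Multiset.card β = Multiset.card γ := by
  have key (p : Polynomial ℂ) :
      (β.map fun x => x * p.eval x).sum = (γ.map fun x => x * p.eval x).sum := by
    induction p using Polynomial.induction_on' with
    | add p q hp hq => simp only [Polynomial.eval_add, mul_add, Multiset.sum_map_add, hp, hq]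
    | monomial n a =>
      have hx (x : ℂ) : x * (Polynomial.monomial n a).eval x = a * x ^ (n + 1) := by
        rw [Polynomial.eval_monomial]; ring
      simp only [hx, Multiset.sum_map_mul_left, h (n + 1) (Nat.le_add_left 1 n)]
  let S : Finset ℂ := (β + γ).toFinset
  have inv_eval (x : ℂ) (hx : x ∈ S) (hx0 : x ≠ 0) :
      x * (Lagrange.interpolate S id fun y => y⁻¹).eval x = 1 := by
    have e := Lagrange.eval_interpolate_at_node (v := id) (fun y : ℂ => y⁻¹)
      Function.injective_id.injOn hx
    rw [id] at e
    rw [e, mul_inv_cancel₀ hx0]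
  have sum_eq_card (δ : Multiset ℂ) (hδ : (0 : ℂ) ∉ δ) (hS : ∀ x ∈ δ, x ∈ S) :
      (δ.map fun x => x * (Lagrange.interpolate S id fun y => y⁻¹).eval x).sum =
        (Multiset.card δ : ℂ) := by
    rw [Multiset.map_congr rfl fun x hx => inv_eval x (hS x hx) (ne_of_mem_of_not_mem hx hδ)]
    simp
  have e := key (Lagrange.interpolate S id fun y => y⁻¹)
  rw [sum_eq_card β hβ fun x hx => by simp [S, hx],
    sum_eq_card γ hγ fun x hx => by simp [S, hx]] at e
  exact_mod_cast e

/-- A sequence has unitary rank `r` iff it is the sequence of power sums of `r` nonzero complex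
numbers: minimality of `r` is automatic. -/
theorem unitaryRank_iff_exists_sum_pow (c : ℕ → ℂ) (r : ℕ) (hr : 0 < r) :
    UnitaryRank c r ↔
      ∃ β : Fin r → ℂ, (∀ i, β i ≠ 0) ∧ ∀ n : ℕ, 1 ≤ n → c n = ∑ i, β i ^ n := by
  constructor
  · rintro ⟨⟨-, β, hcard, h0, hc⟩, -⟩
    induction β using Quotient.inductionOn with
    | h l =>
      obtain rfl : l.length = r := by simpa using hcard
      refine ⟨l.get, fun i hi => h0 ?_, fun n hn => ?_⟩
      · rw [← hi]
        exact List.get_mem l i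
      · simp [hc n hn, ← Fin.sum_univ_fun_getElem]
  · rintro ⟨β, h0, hc⟩
    have hβ : (0 : ℂ) ∉ Finset.univ.val.map β := by simp [h0]
    have hsum (n : ℕ) (hn : 1 ≤ n) : c n = ((Finset.univ.val.map β).map (· ^ n)).sum := by
      rw [hc n hn, Multiset.map_map]
      rfl
    refine ⟨⟨hr, _, by simp, hβ, hsum⟩, ?_⟩
    rintro s ⟨-, γ, rfl, hγ, hcγ⟩
    have e := Multiset.card_eq_of_sum_map_pow_eq hβ hγ fun n hn =>
      (hsum n hn).symm.trans (hcγ n hn)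
    simpa using e.le

/-- The entries of `Vᵀ Dᵗ V` are power sums. -/
theorem transpose_mul_diagonal_pow_mul_apply {r : ℕ} (β : Fin r → ℂ) (t : ℕ) (i j : Fin r) :
    ((Matrix.of fun i j : Fin r => β i ^ (j : ℕ))ᵀ * (Matrix.diagonal β) ^ t *
      (Matrix.of fun i j : Fin r => β i ^ (j : ℕ))) i j =
        ∑ k, β k ^ (t + (i : ℕ) + (j : ℕ)) := by
  rw [Matrix.diagonal_pow, Matrix.mul_apply]
  refine Finset.sum_congr rfl fun k _ => ?_
  rw [Matrix.mul_diagonal]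
  simp only [Matrix.transpose_apply, Matrix.of_apply, Pi.pow_apply]
  ring

/-- `c` has unitary rank `r` iff, setting `c'_0 = r` and `c'_n = c_n` for
`n ≥ 1`, there are nonzero `β₁,…,β_r` such that for every `t ≥ 0` the `r × r` Hankel
matrix `H'_{r-1,t}` (with `(i,j)` entry `c'_{t+i+j}`) equals `Vᵀ Dᵗ V`, where `V` is the
`r × r` Vandermonde matrix with `(i,j)` entry `βᵢ^j` and `D = diag(β₁,…,β_r)`. -/
theorem unitaryRank_iff_hankel_power_decomposition (c : ℕ → ℂ) (r : ℕ) (hr : 0 < r) :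
    UnitaryRank c r ↔
      ∃ β : Fin r → ℂ, (∀ i, β i ≠ 0) ∧
        ∀ t : ℕ,
          (Matrix.of fun i j : Fin r => augSeq c r (t + (i : ℕ) + (j : ℕ))) =
            (Matrix.of fun i j : Fin r => β i ^ (j : ℕ))ᵀ * (Matrix.diagonal β) ^ t *
              (Matrix.of fun i j : Fin r => β i ^ (j : ℕ)) := by
  rw [unitaryRank_iff_exists_sum_pow c r hr]
  refine exists_congr fun β => and_congr_right fun _ => ⟨fun hc t => ?_, fun h n hn => ?_⟩
  · ext i j
    rw [transpose_mul_diagonal_pow_mul_apply, Matrix.of_apply, augSeq]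
    split_ifs with hn
    · simp [hn]
    · exact hc _ (Nat.one_le_iff_ne_zero.mpr hn)
  · have e := congr_fun₂ (h n) ⟨0, hr⟩ ⟨0, hr⟩
    rw [transpose_mul_diagonal_pow_mul_apply] at e
    simpa [augSeq, Nat.one_le_iff_ne_zero.mp hn] using e
end
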